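/- Let n >= 1 and let q = p^h with p prime. Let pi be an n-dimensional projective subspace of PG(2n+1,q^2) such that pi intersect pi^sigma has projective dimension i with -1 <= i <= n-2. Then the number of points of H(2n+1,q^2) lying on exactly one of pi and pi^sigma equals 2*q^{2i+2}*mu_{n-i-1}(q^2); consequently, for every nonzero alpha in F_p, the weight of the code word alpha*(v_pi - v_{pi^sigma}) equals 2*q^{2i+2}*mu_{n-i-1}(q^2). -/

import Mathlib

open scoped BigOperators

namespace HermCode

/-- The Hermitian sesquilinear form `h(x,y) = ∑ᵢ xᵢ * yᵢ^q` on `F^m`. -/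
def herm (q : ℕ) {F : Type} [Field F] {m : ℕ} (x y : Fin m → F) : F :=
  ∑ i, x i * (y i) ^ q

/-- For a fixed vector `x`, the linear map `y ↦ h(y,x)`. -/
def hermL (q : ℕ) {F : Type} [Field F] {m : ℕ} (x : Fin m → F) :
    (Fin m → F) →ₗ[F] F where
  toFun y := herm q y x
  map_add' a b := by
    simp [herm, add_mul, Finset.sum_add_distrib]
  map_smul' c a := by
    simp [herm, Finset.mul_sum, mul_assoc]

/-- The image `W^σ` of a subspace `W` under the Hermitian polarity `σ`:
the subspace of all vectors orthogonal to every vector of `W`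
with respect to the Hermitian form. -/
def polar (q : ℕ) {F : Type} [Field F] {m : ℕ} (W : Submodule F (Fin m → F)) :
    Submodule F (Fin m → F) :=
  ⨅ x : W, LinearMap.ker (hermL q (x : Fin m → F))

/-- A subspace all of whose points lie on the Hermitian variety. -/
def TotallyIsotropic (q : ℕ) {F : Type} [Field F] {m : ℕ}
    (W : Submodule F (Fin m → F)) : Prop :=
  ∀ x ∈ W, herm q x x = 0

/-- A point of the Hermitian variety: a projective point (1-dimensional subspace)
spanned by an isotropic vector. -/
def IsHermPoint (q : ℕ) {F : Type} [Field F] {m : ℕ}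
    (P : Submodule F (Fin m → F)) : Prop :=
  Module.finrank F P = 1 ∧ TotallyIsotropic q P

/-- A generator of `H(2n+1,q²)`: an `n`-dimensional projective subspace all of
whose points lie on the Hermitian variety. -/
def IsGenerator (q n : ℕ) {F : Type} [Field F]
    (W : Submodule F (Fin (2*n+2) → F)) : Prop :=
  Module.finrank F W = n + 1 ∧ TotallyIsotropic q W

/-- A code word of the dual code `C_n(H(2n+1,q²))^⊥`: a function from points to `F_p`
(vanishing off the Hermitian variety) summing to zero over every generator. -/
def IsCodeword (p q n : ℕ) {F : Type} [Field F]
    (c : Submodule F (Fin (2*n+2) → F) → ZMod p) : Prop :=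
  (∀ P, ¬ IsHermPoint q P → c P = 0) ∧
  ∀ μ, IsGenerator q n μ → (∑ᶠ P ∈ {P | IsHermPoint q P ∧ P ≤ μ}, c P) = 0

/-- The (Hamming) weight of a code word. -/
noncomputable def wt {p : ℕ} {α : Type*} (c : α → ZMod p) : ℕ :=
  Nat.card {x : α // c x ≠ 0}

open scoped Classical in
/-- The incidence vector `v_π` of `π ∩ H`. -/
noncomputable def vsub (p q : ℕ) {F : Type} [Field F] {m : ℕ}
    (π : Submodule F (Fin m → F)) : Submodule F (Fin m → F) → ZMod p :=
  fun P => if IsHermPoint q P ∧ P ≤ π then 1 else 0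

/-- `θ_m(q)`, the number of points of `PG(m,q)`. -/
noncomputable def theta (q : ℕ) (m : ℤ) : ℚ :=
  ((q:ℚ)^(m+1) - 1) / ((q:ℚ) - 1)

/-- `μ_m(q²)`, the number of points of `H(m,q²)` (with `μ_{-1} = 0`). -/
noncomputable def muH (q : ℕ) (m : ℤ) : ℚ :=
  (((q:ℚ)^(m+1) - (-1:ℚ)^(m+1)) * ((q:ℚ)^m - (-1:ℚ)^m)) / ((q:ℚ)^2 - 1)

/-- The number `N(n,i)`. -/
noncomputable def NN (q n : ℕ) (i : ℤ) : ℚ :=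
  (q:ℚ)^(((n:ℤ)-1)^2 - ((((n:ℤ)-i-1).toNat.choose 2 : ℕ) : ℤ)) *
    ∏ j ∈ Finset.range ((n:ℤ)-i-2).toNat, ((q:ℚ)^(j+1) - (-1:ℚ)^(j+1))

open scoped Classical in
/-- The quantity `Σ_{n,i}`. -/
noncomputable def SigmaNI (q n : ℕ) (i : ℤ) : ℚ :=
  if Odd ((n:ℤ) - i) then
    2*(q:ℚ)^(2*i+2) * muH q ((n:ℤ)-i-1)
      + 4 * muH q ((n:ℤ)-i-2) * ((q:ℚ)^((n:ℤ)-i-1) - 1)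
          / ((q:ℚ)^((n:ℤ)-3*i-5) * ((q:ℚ)^2 - 1))
  else
    2*(q:ℚ)^(2*i+2) * (muH q ((n:ℤ)-i-1)
      + 2*((q:ℚ)^(4:ℤ) * muH q ((n:ℤ)-i-3) + (q:ℚ)^2 - 1)/((q:ℚ)^2 - 1))

/-- `P` lies on a projective line entirely contained in the Hermitian variety that
meets both `π \ (π ⊓ π^σ)` and `π^σ \ (π ⊓ π^σ)`. -/
def OnGoodLine (q : ℕ) {F : Type} [Field F] {m : ℕ}
    (π P : Submodule F (Fin m → F)) : Prop :=
  ∃ A B : Submodule F (Fin m → F),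
    Module.finrank F A = 1 ∧ A ≤ π ∧ ¬ A ≤ π ⊓ polar q π ∧
    Module.finrank F B = 1 ∧ B ≤ polar q π ∧ ¬ B ≤ π ⊓ polar q π ∧
    P ≤ A ⊔ B ∧ TotallyIsotropic q (A ⊔ B)

/-- Standing assumptions: `F` has `q^2` elements and `a ↦ a^q` is an additive involution. -/
structure QData (q : ℕ) (F : Type) [Field F] [Fintype F] : Prop where
  two_le : 2 ≤ q
  card : Fintype.card F = q ^ 2
  add : ∀ a b : F, (a + b) ^ q = a ^ q + b ^ q
  inv : ∀ a : F, (a ^ q) ^ q = a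

section helpers

variable {q : ℕ} {F : Type} [Field F] [Fintype F] {m : ℕ}

theorem QData.gen (H : QData q F) : ∃ g : F, g ≠ 0 ∧ orderOf g = q ^ 2 - 1 ∧
    ∀ b : F, b ≠ 0 → ∃ k : ℕ, g ^ k = b := by
  classical
  obtain ⟨g, hg⟩ := IsCyclic.exists_generator (α := Fˣ)
  refine ⟨g, g.ne_zero, ?_, ?_⟩
  · rw [orderOf_units, orderOf_eq_card_of_forall_mem_zpowers hg, Nat.card_eq_fintype_card,
      Fintype.card_units, H.card]
  · intro b hb
    obtain ⟨k, hk⟩ := (mem_powers_iff_mem_zpowers (x := g) (y := Units.mk0 b hb)).2 (hg _)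
    refine ⟨k, ?_⟩
    have := congrArg Units.val hk
    simpa using this

theorem sq_sub_one (q : ℕ) : q ^ 2 - 1 = (q + 1) * (q - 1) := by
  rw [show q ^ 2 - 1 = q ^ 2 - 1 ^ 2 by simp, Nat.sq_sub_sq]

theorem QData.card_norm (H : QData q F) (b : F) (hb : b ≠ 0) (hbq : b ^ q = b) :
    Nat.card {t : F // t ^ (q + 1) = b} = q + 1 := by
  classical
  have h2 := H.two_le
  obtain ⟨g, hg0, hg, hgen⟩ := H.gen
  have hprim : IsPrimitiveRoot (g ^ (q - 1)) (q + 1) := by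
    have h1 : IsPrimitiveRoot g (q ^ 2 - 1) := hg ▸ IsPrimitiveRoot.orderOf g
    refine h1.pow ?_ ?_
    · rw [sq_sub_one]; exact Nat.mul_pos (by omega) (by omega)
    · rw [sq_sub_one, mul_comm]
  have hex : ∃ α : F, α ^ (q + 1) = b := by
    obtain ⟨k, hk⟩ := hgen b hb
    have hb1 : b ^ (q - 1) = 1 := by
      have : b ^ (q - 1) * b = 1 * b := by
        rw [← pow_succ, Nat.sub_add_cancel (by omega), hbq, one_mul]
      exact mul_right_cancel₀ hb this
    rw [← hk, ← pow_mul] at hb1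
    have hd := orderOf_dvd_of_pow_eq_one hb1
    rw [hg, sq_sub_one] at hd
    obtain ⟨j, hj⟩ := Nat.dvd_of_mul_dvd_mul_right (by omega) hd
    refine ⟨g ^ j, ?_⟩
    rw [← hk, hj, ← pow_mul, mul_comm]
  have hc := hprim.card_nthRoots b
  rw [if_pos hex] at hc
  have hnd := hprim.nthRoots_nodup hb
  rw [← Multiset.toFinset_card_of_nodup hnd] at hc
  refine Eq.trans ?_ hc
  rw [← Nat.card_eq_finsetCard]
  refine Nat.card_congr (Equiv.subtypeEquivRight fun t => ?_)
  simp [Polynomial.mem_nthRoots]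

theorem herm_add_left (x y z : Fin m → F) : herm q (x + y) z = herm q x z + herm q y z :=
  (hermL q z).map_add x y

theorem herm_smul_left (c : F) (x z : Fin m → F) : herm q (c • x) z = c * herm q x z :=
  (hermL q z).map_smul c x

theorem QData.q_ne (H : QData q F) : q ≠ 0 := by have := H.two_le; omega

theorem QData.sum_pow (H : QData q F) {ι : Type} (s : Finset ι) (f : ι → F) :
    (∑ i ∈ s, f i) ^ q = ∑ i ∈ s, f i ^ q := by
  classical
  induction s using Finset.induction_on with
  | empty => simp [H.q_ne]
  | insert a s ha ih => rw [Finset.sum_insert ha, Finset.sum_insert ha, H.add, ih]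

theorem QData.herm_symm (H : QData q F) (x y : Fin m → F) : herm q x y = (herm q y x) ^ q := by
  unfold herm
  rw [H.sum_pow]
  refine Finset.sum_congr rfl fun i _ => ?_
  rw [mul_pow, H.inv, mul_comm]

theorem QData.herm_add_right (H : QData q F) (x y z : Fin m → F) :
    herm q x (y + z) = herm q x y + herm q x z := by
  simp only [herm, Pi.add_apply, H.add, mul_add, Finset.sum_add_distrib]

theorem herm_smul_right (c : F) (x y : Fin m → F) :
    herm q x (c • y) = c ^ q * herm q x y := by
  simp only [herm, Pi.smul_apply, smul_eq_mul, mul_pow, Finset.mul_sum]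
  exact Finset.sum_congr rfl fun i _ => by ring

theorem mem_polar {W : Submodule F (Fin m → F)} {y : Fin m → F} :
    y ∈ polar q W ↔ ∀ x ∈ W, herm q y x = 0 := by
  simp only [polar, Submodule.mem_iInf, LinearMap.mem_ker, Subtype.forall]
  rfl

/-- Totally isotropic subspaces are contained in their polar. -/
theorem QData.le_polar (H : QData q F) {W : Submodule F (Fin m → F)}
    (hW : TotallyIsotropic q W) : W ≤ polar q W := by
  intro x hx
  rw [mem_polar]
  intro y hy
  by_contra ha
  set a := herm q x y with hadef
  have key : ∀ t : F, t ^ q * a + t * a ^ q = 0 := by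
    intro t
    have h1 := hW (x + t • y) (W.add_mem hx (W.smul_mem t hy))
    rw [herm_add_left, H.herm_add_right, H.herm_add_right, herm_smul_left, herm_smul_left,
      herm_smul_right, hW x hx, herm_smul_right, hW y hy, H.herm_symm y x] at h1
    simpa using h1
  have k1 := key 1
  rw [one_pow, one_mul, one_mul] at k1
  have haq : a ^ q = -a := by linear_combination k1
  have k2 : ∀ t : F, t ^ q = t := by
    intro t
    have := key t
    rw [haq] at this
    have h3 : (t ^ q - t) * a = 0 := by linear_combination this
    have := (mul_eq_zero.1 h3).resolve_right ha
    exact sub_eq_zero.1 this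
  obtain ⟨g, hg0, hg, -⟩ := H.gen
  have h2 := H.two_le
  have hg1 : g ^ (q - 1) = 1 := by
    have : g ^ (q - 1) * g = 1 * g := by
      rw [← pow_succ, Nat.sub_add_cancel (by omega), k2, one_mul]
    exact mul_right_cancel₀ hg0 this
  have hd := orderOf_dvd_of_pow_eq_one hg1
  have hle := Nat.le_of_dvd (by omega) hd
  rw [hg, sq_sub_one] at hle
  have : 0 < q - 1 := by omega
  nlinarith

/-- The set of functionals `h(·,x)`, `x ∈ W`, as a subspace of the dual. -/
def hermDual (H : QData q F) (W : Submodule F (Fin m → F)) :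
    Submodule F (Module.Dual F (Fin m → F)) where
  carrier := {f | ∃ x ∈ W, hermL q x = f}
  add_mem' := by
    rintro _ _ ⟨x, hx, rfl⟩ ⟨y, hy, rfl⟩
    exact ⟨x + y, W.add_mem hx hy, LinearMap.ext fun z => H.herm_add_right z x y⟩
  zero_mem' := ⟨0, W.zero_mem, LinearMap.ext fun z => by
    change herm q z 0 = 0
    simp [herm, H.q_ne]⟩
  smul_mem' := by
    rintro c _ ⟨x, hx, rfl⟩
    refine ⟨c ^ q • x, W.smul_mem _ hx, LinearMap.ext fun z => ?_⟩
    change herm q z (c ^ q • x) = c * herm q z x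
    rw [herm_smul_right, H.inv]

theorem QData.hermL_injective (H : QData q F) :
    Function.Injective (fun x : Fin m → F => hermL q x) := by
  intro x y hxy
  funext i
  have h1 : herm q (Pi.single i 1) x = herm q (Pi.single i 1) y :=
    LinearMap.congr_fun hxy (Pi.single i 1)
  simp only [herm, Pi.single_apply, ite_mul, one_mul, zero_mul, Finset.sum_ite_eq',
    Finset.mem_univ, if_true] at h1
  rw [← H.inv (x i), h1, H.inv]

theorem QData.card_sub (H : QData q F) {V : Type} [AddCommGroup V] [Module F V]
    [Module.Finite F V] (W : Submodule F V) :
    Nat.card W = q ^ (2 * Module.finrank F W) := by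
  rw [Module.natCard_eq_pow_finrank (K := F), Nat.card_eq_fintype_card, H.card, ← pow_mul]

theorem QData.finrank_polar (H : QData q F) (W : Submodule F (Fin m → F)) :
    Module.finrank F W + Module.finrank F (polar q W) = m := by
  have h1 : polar q W = (hermDual H W).dualCoannihilator := by
    ext y
    rw [mem_polar, Submodule.mem_dualCoannihilator]
    constructor
    · rintro h _ ⟨x, hx, rfl⟩
      exact h x hx
    · intro h x hx
      exact h _ ⟨x, hx, rfl⟩
  have h2 : Nat.card W = Nat.card (hermDual H W) := by
    refine Nat.card_eq_of_bijective
      (fun x : W => (⟨hermL q x.1, x.1, x.2, rfl⟩ : hermDual H W)) ⟨?_, ?_⟩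
    · intro x y hxy
      exact Subtype.ext (H.hermL_injective (congrArg Subtype.val hxy))
    · rintro ⟨_, x, hx, rfl⟩
      exact ⟨⟨x, hx⟩, rfl⟩
  rw [H.card_sub, H.card_sub] at h2
  have h3 := Nat.pow_right_injective H.two_le h2
  have h4 := Subspace.finrank_add_finrank_dualCoannihilator_eq (hermDual H W)
  rw [← h1, Module.finrank_fin_fun] at h4
  omega

theorem QData.polar_polar (H : QData q F) (W : Submodule F (Fin m → F)) :
    polar q (polar q W) = W := by
  symm
  refine Submodule.eq_of_le_of_finrank_eq ?_ ?_
  · intro x hx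
    rw [mem_polar]
    intro y hy
    rw [H.herm_symm, mem_polar.1 hy x hx, zero_pow H.q_ne]
  · have h1 := H.finrank_polar W
    have h2 := H.finrank_polar (polar q W)
    omega

/-- Number of isotropic vectors of a subspace. -/
noncomputable def isoCount (q : ℕ) (W : Submodule F (Fin m → F)) : ℕ :=
  Nat.card {v : W // herm q v.1 v.1 = 0}

/-- Splitting off a non-isotropic vector. -/
theorem QData.isoCount_step (H : QData q F) (W W' : Submodule F (Fin m → F)) (x : Fin m → F)
    (hx : x ∈ W) (ha : herm q x x ≠ 0)
    (hW' : ∀ y, y ∈ W' ↔ y ∈ W ∧ herm q y x = 0) :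
    isoCount q W + q * isoCount q W' = (q + 1) * Nat.card W' ∧
      Nat.card W = Nat.card W' * q ^ 2 := by
  classical
  set a := herm q x x with hadef
  have haq : a ^ q = a := (H.herm_symm x x).symm
  let f : W' × F → W := fun z => ⟨z.1.1 + z.2 • x,
    W.add_mem ((hW' _).1 z.1.2).1 (W.smul_mem _ hx)⟩
  have hf : Function.Bijective f := by
    constructor
    · rintro ⟨w, t⟩ ⟨w', t'⟩ h
      have h1 : w.1 + t • x = w'.1 + t' • x := congrArg Subtype.val h
      have h2 := congrArg (fun z => herm q z x) h1
      simp only [herm_add_left, herm_smul_left, ((hW' _).1 w.2).2, ((hW' _).1 w'.2).2,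
        zero_add] at h2
      have h3 : t = t' := mul_right_cancel₀ ha h2
      subst h3
      have h4 : w = w' := Subtype.ext (add_right_cancel h1)
      rw [h4]
    · intro v
      refine ⟨⟨⟨v.1 - (herm q v.1 x / a) • x, ?_⟩, herm q v.1 x / a⟩, ?_⟩
      · rw [hW']
        refine ⟨W.sub_mem v.2 (W.smul_mem _ hx), ?_⟩
        rw [sub_eq_add_neg, ← neg_smul, herm_add_left, herm_smul_left, ← hadef]
        field_simp
        ring
      · exact Subtype.ext (sub_add_cancel _ _)
  have hform : ∀ z : W' × F, herm q (f z).1 (f z).1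
      = herm q z.1.1 z.1.1 + z.2 ^ (q + 1) * a := by
    rintro ⟨w, t⟩
    have h1 : herm q w.1 x = 0 := ((hW' _).1 w.2).2
    have h2 : herm q x w.1 = 0 := by rw [H.herm_symm, h1, zero_pow H.q_ne]
    change herm q (w.1 + t • x) (w.1 + t • x) = herm q w.1 w.1 + t ^ (q + 1) * a
    rw [herm_add_left, H.herm_add_right, H.herm_add_right, herm_smul_left, herm_smul_left,
      herm_smul_right, herm_smul_right, h1, h2]
    ring
  constructor
  · have hN : isoCount q W
        = ∑ w : W', Nat.card {t : F // herm q w.1 w.1 + t ^ (q + 1) * a = 0} := by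
      rw [← Nat.card_sigma]
      symm
      refine Nat.card_eq_of_bijective
        (fun z : (Σ w : W', {t : F // herm q w.1 w.1 + t ^ (q + 1) * a = 0}) =>
          (⟨f (z.1, z.2.1), by rw [hform]; exact z.2.2⟩ :
            {v : W // herm q v.1 v.1 = 0})) ⟨?_, ?_⟩
      · rintro ⟨w, t, ht⟩ ⟨w', t', ht'⟩ h
        have h1 := hf.1 (congrArg Subtype.val h)
        simp only [Prod.mk.injEq] at h1
        obtain ⟨rfl, rfl⟩ := h1
        rfl
      · rintro ⟨v, hv⟩
        obtain ⟨⟨w, t⟩, rfl⟩ := hf.2 v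
        rw [hform] at hv
        exact ⟨⟨w, t, hv⟩, rfl⟩
    have hterm : ∀ w : W', Nat.card {t : F // herm q w.1 w.1 + t ^ (q + 1) * a = 0}
        + q * (if herm q w.1 w.1 = 0 then 1 else 0) = q + 1 := by
      intro w
      by_cases hw : herm q w.1 w.1 = 0
      · rw [if_pos hw, hw]
        have : Nat.card {t : F // 0 + t ^ (q + 1) * a = 0} = 1 := by
          rw [Nat.card_eq_one_iff_unique]
          refine ⟨⟨?_⟩, ⟨⟨0, by simp⟩⟩⟩
          rintro ⟨s, hs⟩ ⟨t, ht⟩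
          simp [ha] at hs ht
          simp [hs, ht]
        rw [this]; ring
      · rw [if_neg hw, mul_zero, add_zero]
        set c := herm q w.1 w.1 with hc
        have hcq : c ^ q = c := (H.herm_symm w.1 w.1).symm
        have hneg : (-1 : F) ^ q = -1 := by
          have h0 := H.add 1 (-1)
          rw [add_neg_cancel, zero_pow H.q_ne, one_pow] at h0
          linear_combination -h0
        refine Eq.trans ?_ (H.card_norm (-1 * c / a) (div_ne_zero (mul_ne_zero (by simp) hw) ha)
          (by rw [div_pow, mul_pow, hcq, haq, hneg]))
        refine Nat.card_congr (Equiv.subtypeEquivRight fun t => ?_)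
        rw [eq_div_iff ha]
        constructor
        · intro h; linear_combination h
        · intro h; linear_combination h
    have hN' : isoCount q W' = ∑ w : W', (if herm q w.1 w.1 = 0 then 1 else 0) := by
      rw [isoCount, Nat.card_eq_fintype_card, Fintype.card_subtype, Finset.card_filter]
    rw [hN, hN', Finset.mul_sum, ← Finset.sum_add_distrib, Finset.sum_congr rfl
      (fun w _ => hterm w)]
    simp [mul_comm]
  · rw [← Nat.card_eq_of_bijective f hf, Nat.card_prod, Nat.card_eq_fintype_card (α := F), H.card]

/-- The number of isotropic vectors in a subspace of dimension `d` with radical of dimension `r`. -/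
theorem QData.isoCount_eq (H : QData q F) (d : ℕ) : ∀ (W : Submodule F (Fin m → F)) (r : ℕ),
    Module.finrank F W = d → Module.finrank F ↥(W ⊓ polar q W) = r →
    (q : ℤ) * isoCount q W = (q : ℤ) ^ (2 * d) + ((q : ℤ) - 1) * (-(q : ℤ)) ^ (d + r) := by
  induction d with
  | zero =>
    intro W r hW hr
    have h1 : r ≤ 0 := by
      rw [← hW, ← hr]; exact Submodule.finrank_mono inf_le_left
    have h2 : W = ⊥ := Submodule.finrank_eq_zero.1 hW
    have h3 : isoCount q W = 1 := by
      subst h2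
      rw [isoCount, Nat.card_eq_one_iff_unique]
      refine ⟨inferInstance, ⟨⟨0, ?_⟩⟩⟩
      simp [herm]
    obtain rfl : r = 0 := by omega
    rw [h3]; simp
  | succ d ih =>
    intro W r hW hr
    by_cases hti : TotallyIsotropic q W
    · have h1 : W ⊓ polar q W = W := inf_eq_left.2 (H.le_polar hti)
      rw [h1, hW] at hr
      subst hr
      have h2 : isoCount q W = q ^ (2 * (d + 1)) := by
        rw [← hW, ← H.card_sub W, isoCount]
        exact Nat.card_congr (Equiv.subtypeUnivEquiv fun v => hti v.1 v.2)
      rw [h2, ← two_mul, pow_mul (-(q : ℤ)), neg_sq, ← pow_mul]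
      push_cast
      ring
    · unfold TotallyIsotropic at hti
      push Not at hti
      obtain ⟨x, hx, ha⟩ := hti
      let W' : Submodule F (Fin m → F) := W ⊓ LinearMap.ker (hermL q x)
      have hW' : ∀ y, y ∈ W' ↔ y ∈ W ∧ herm q y x = 0 := fun y => Iff.rfl
      obtain ⟨hs, hc⟩ := H.isoCount_step W W' x hx ha hW'
      have hd : Module.finrank F W' = d := by
        rw [H.card_sub, H.card_sub, ← pow_add, hW] at hc
        have := Nat.pow_right_injective H.two_le hc
        omega
      have hrad : W' ⊓ polar q W' = W ⊓ polar q W := by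
        ext y
        simp only [Submodule.mem_inf, mem_polar, hW']
        constructor
        · rintro ⟨⟨hy, hyx⟩, h⟩
          refine ⟨hy, fun z hz => ?_⟩
          have h1 := h (z + (-(herm q z x / herm q x x)) • x)
            ⟨W.add_mem hz (W.smul_mem _ hx), by
              rw [herm_add_left, herm_smul_left]; field_simp; ring⟩
          rw [H.herm_add_right, herm_smul_right, hyx, mul_zero, add_zero] at h1
          exact h1
        · rintro ⟨hy, h⟩
          exact ⟨⟨hy, h x hx⟩, fun z hz => h z hz.1⟩
      have hI := ih W' r hd (by rw [hrad]; exact hr)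
      rw [H.card_sub, hd] at hs
      have hs' : (isoCount q W : ℤ) + q * isoCount q W' = (q + 1) * (q : ℤ) ^ (2 * d) := by
        exact_mod_cast hs
      have e1 : (q : ℤ) ^ (2 * (d + 1)) = q ^ (2 * d) * q ^ 2 := by ring
      have e2 : (-(q : ℤ)) ^ (d + 1 + r) = -q * (-(q : ℤ)) ^ (d + r) := by ring
      rw [e1, e2]
      linear_combination (q : ℤ) * hs' - (q : ℤ) * hI

/-- Points of the Hermitian variety in `W` but not in `W ∩ W^σ`. -/
noncomputable def ptCount (q : ℕ) (W R : Submodule F (Fin m → F)) : ℕ :=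
  Nat.card {P : Submodule F (Fin m → F) // IsHermPoint q P ∧ P ≤ W ∧ ¬ P ≤ R}

theorem QData.ptCount_mul (H : QData q F) (W R : Submodule F (Fin m → F)) (hR : R ≤ W)
    (hRiso : TotallyIsotropic q R) :
    ptCount q W R * (q ^ 2 - 1) + Nat.card R = isoCount q W := by
  classical
  let B := {P : Submodule F (Fin m → F) // IsHermPoint q P ∧ P ≤ W ∧ ¬ P ≤ R}
  have : Fintype B := Fintype.ofFinite B
  have hspan : ∀ (P : B) (v : Fin m → F), v ∈ P.1 → v ≠ 0 → P.1 = Submodule.span F {v} := by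
    intro P v hv h0
    symm
    refine Submodule.eq_of_le_of_finrank_eq ?_ ?_
    · rw [Submodule.span_singleton_le_iff_mem]; exact hv
    · rw [finrank_span_singleton h0, P.2.1.1]
  let f : (Σ P : B, {v : P.1 // v ≠ 0}) ⊕ R → {v : W // herm q v.1 v.1 = 0} := fun z =>
    match z with
    | Sum.inl z => ⟨⟨z.2.1.1, z.1.2.2.1 z.2.1.2⟩, z.1.2.1.2 _ z.2.1.2⟩
    | Sum.inr r => ⟨⟨r.1, hR r.2⟩, hRiso _ r.2⟩
  have hnot : ∀ (P : B) (v : Fin m → F), v ∈ P.1 → v ≠ 0 → v ∉ R := by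
    intro P v hv h0 hvR
    apply P.2.2.2
    rw [hspan P v hv h0, Submodule.span_singleton_le_iff_mem]
    exact hvR
  have hf : Function.Bijective f := by
    constructor
    · rintro (⟨P, ⟨v, hv⟩, h0⟩ | ⟨r, hr⟩) (⟨P', ⟨v', hv'⟩, h0'⟩ | ⟨r', hr'⟩) h
      · have h1 : v = v' := congrArg (fun z => z.1.1) h
        subst h1
        have hv0 : v ≠ 0 := fun h => h0 (Subtype.ext h)
        have h2 : P = P' := Subtype.ext ((hspan P v hv hv0).trans (hspan P' v hv' hv0).symm)
        subst h2
        rfl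
      · have h1 : v = r' := congrArg (fun z => z.1.1) h
        subst h1
        exact absurd hr' (hnot P v hv fun h => h0 (Subtype.ext h))
      · have h1 : r = v' := congrArg (fun z => z.1.1) h
        subst h1
        exact absurd hr (hnot P' r hv' fun h => h0' (Subtype.ext h))
      · have h1 : r = r' := congrArg (fun z => z.1.1) h
        subst h1
        rfl
    · rintro ⟨⟨v, hv⟩, hiso⟩
      by_cases hvR : v ∈ R
      · exact ⟨Sum.inr ⟨v, hvR⟩, rfl⟩
      · have h0 : v ≠ 0 := fun h => hvR (h ▸ R.zero_mem)
        refine ⟨Sum.inl ⟨⟨Submodule.span F {v}, ⟨finrank_span_singleton h0, ?_⟩, ?_, ?_⟩,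
          ⟨v, Submodule.mem_span_singleton_self v⟩, fun h => h0 (congrArg Subtype.val h)⟩, rfl⟩
        · intro y hy
          obtain ⟨c, rfl⟩ := Submodule.mem_span_singleton.1 hy
          rw [herm_smul_left, herm_smul_right]
          have : herm q v v = 0 := hiso
          rw [this]; ring
        · rw [Submodule.span_singleton_le_iff_mem]; exact hv
        · rw [Submodule.span_singleton_le_iff_mem]; exact hvR
  have hcard := Nat.card_eq_of_bijective f hf
  rw [Nat.card_sum, Nat.card_sigma] at hcard
  have hfib : ∀ P : B, Nat.card {v : P.1 // v ≠ 0} = q ^ 2 - 1 := by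
    intro P
    have h1 := H.card_sub P.1
    rw [P.2.1.1, mul_one] at h1
    rw [← h1, Nat.card_eq_fintype_card, Nat.card_eq_fintype_card, Fintype.card_subtype_compl,
      Fintype.card_subtype_eq]
  rw [Finset.sum_congr rfl (fun P _ => hfib P), Finset.sum_const, Finset.card_univ,
    ← Nat.card_eq_fintype_card, smul_eq_mul] at hcard
  exact hcard

theorem QData.ptCount_eq (H : QData q F) (W : Submodule F (Fin m → F)) (r k : ℕ)
    (hW : Module.finrank F W = r + (k + 1)) (hr : Module.finrank F ↥(W ⊓ polar q W) = r) :
    (ptCount q W (W ⊓ polar q W) : ℚ) = (q : ℚ) ^ (2 * r) * muH q k := by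
  have h2 := H.two_le
  have h1 := H.ptCount_mul W (W ⊓ polar q W) inf_le_left (by
    intro x hx
    exact mem_polar.1 hx.2 x hx.1)
  rw [H.card_sub, hr] at h1
  have h3 := H.isoCount_eq _ W r hW hr
  set K := ptCount q W (W ⊓ polar q W)
  rw [← h1] at h3
  push_cast [Nat.cast_sub (show 1 ≤ q ^ 2 by nlinarith)] at h3
  have h4 : (q : ℚ) * (K * ((q : ℚ) ^ 2 - 1) + (q : ℚ) ^ (2 * r))
      = (q : ℚ) ^ (2 * (r + (k + 1))) + ((q : ℚ) - 1) * (-(q : ℚ)) ^ (r + (k + 1) + r) := by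
    exact_mod_cast h3
  have hq2 : (2 : ℚ) ≤ q := by exact_mod_cast h2
  have hne : (q : ℚ) ^ 2 - 1 ≠ 0 := by nlinarith
  have hq0 : (q : ℚ) ≠ 0 := by linarith
  have e1 : (-(q : ℚ)) ^ (r + (k + 1) + r)
      = (q : ℚ) ^ (2 * r) * ((-1) ^ (k + 1) * (q : ℚ) ^ (k + 1)) := by
    rw [← mul_pow, neg_one_mul, show r + (k + 1) + r = 2 * r + (k + 1) by ring, pow_add,
      pow_mul, neg_sq, ← pow_mul]
  have e2 : ((-1 : ℚ) ^ k) ^ 2 = 1 := by rw [← pow_mul, mul_comm, pow_mul]; norm_num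
  rw [muH, show ((k : ℤ) + 1) = ((k + 1 : ℕ) : ℤ) by push_cast; rfl]
  simp only [zpow_natCast]
  rw [← mul_div_assoc, eq_div_iff hne]
  apply mul_left_cancel₀ hq0
  rw [e1] at h4
  simp only [pow_succ (-1 : ℚ) k] at h4 ⊢
  linear_combination h4 + (q : ℚ) * (q : ℚ) ^ (2 * r) * e2

end helpers

theorem QData.of (q p hh : ℕ) (hp : p.Prime) (hh1 : 1 ≤ hh) (hq : q = p ^ hh)
    (F : Type) [Field F] [Fintype F] (hF : Fintype.card F = q ^ 2) : QData q F := by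
  have : Fact p.Prime := ⟨hp⟩
  have hc : CharP F p := by
    obtain ⟨p', hp'⟩ := CharP.exists F
    obtain ⟨k, hpr, hk⟩ := FiniteField.card F p'
    have hdvd : p' ∣ p := by
      have : p' ∣ (p ^ hh) ^ 2 := by
        rw [← hq, ← hF, hk]; exact dvd_pow_self _ k.ne_zero
      exact hpr.dvd_of_dvd_pow (hpr.dvd_of_dvd_pow this)
    rw [← (Nat.prime_dvd_prime_iff_eq hpr hp).1 hdvd]
    exact hp'
  refine ⟨?_, hF, ?_, ?_⟩
  · rw [hq]; exact hp.two_le.trans (Nat.le_self_pow (by omega) p)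
  · intro a b
    rw [hq]; exact add_pow_char_pow a b p hh
  · intro a
    rw [← pow_mul, ← sq, ← hF, FiniteField.pow_card]

/-- If `π ∩ π^σ` has projective dimension `i` with `-1 ≤ i ≤ n-2`, then the number
of points of `H(2n+1,q²)` on exactly one of `π`, `π^σ` is `2q^(2i+2)·μ_(n-i-1)(q²)`,
and this is the weight of `α • (v_π - v_(π^σ))` for every `α ≠ 0`. -/
theorem stmt3 (n q p hh : ℕ) (hn : 1 ≤ n) (hp : p.Prime) (hh1 : 1 ≤ hh)
    (hq : q = p ^ hh)
    (F : Type) [Field F] [Fintype F] (hF : Fintype.card F = q ^ 2)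
    (π : Submodule F (Fin (2*n+2) → F)) (hπ : Module.finrank F π = n + 1)
    (i : ℤ) (hi1 : -1 ≤ i) (hi2 : i ≤ (n:ℤ) - 2)
    (hdim : (Module.finrank F ↥(π ⊓ polar q π) : ℤ) = i + 1) :
    ((Nat.card {P : Submodule F (Fin (2*n+2) → F) //
        IsHermPoint q P ∧ Xor' (P ≤ π) (P ≤ polar q π)} : ℚ)
      = 2 * (q:ℚ)^(2*i+2) * muH q ((n:ℤ)-i-1)) ∧
    ∀ α : ZMod p, α ≠ 0 →
      ((wt (fun P => α * (vsub p q π P - vsub p q (polar q π) P)) : ℚ)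
        = 2 * (q:ℚ)^(2*i+2) * muH q ((n:ℤ)-i-1)) := by
  have H := QData.of q p hh hp hh1 hq F hF
  obtain ⟨r, hr⟩ : ∃ r : ℕ, Module.finrank F ↥(π ⊓ polar q π) = r := ⟨_, rfl⟩
  rw [hr] at hdim
  obtain ⟨k, hk⟩ : ∃ k : ℕ, (n : ℤ) - i - 1 = k := ⟨((n : ℤ) - i - 1).toNat, by omega⟩
  have hpp := H.polar_polar π
  have hpd := H.finrank_polar π
  have c1 := H.ptCount_eq π r k (by omega) hr
  have c2 := H.ptCount_eq (polar q π) r k (by omega) (by rw [hpp, inf_comm]; exact hr)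
  rw [hpp, inf_comm] at c2
  have hfirst : (Nat.card {P : Submodule F (Fin (2*n+2) → F) //
        IsHermPoint q P ∧ Xor' (P ≤ π) (P ≤ polar q π)} : ℚ)
      = 2 * (q:ℚ)^(2*i+2) * muH q ((n:ℤ)-i-1) := by
    have hsum : Nat.card {P : Submodule F (Fin (2*n+2) → F) //
        IsHermPoint q P ∧ Xor' (P ≤ π) (P ≤ polar q π)}
        = ptCount q π (π ⊓ polar q π) + ptCount q (polar q π) (π ⊓ polar q π) := by
      classical
      unfold ptCount
      rw [← Nat.card_sum]
      symm
      rw [← Nat.card_congr (subtypeOrEquiv _ _ ?_)]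
      · refine Nat.card_congr (Equiv.subtypeEquivRight fun P => ?_)
        simp only [Xor', Xor, le_inf_iff]
        tauto
      · rw [Pi.disjoint_iff]
        intro P
        simp only [le_inf_iff, Prop.disjoint_iff]
        tauto
    rw [hsum, Nat.cast_add, c1, c2, hk, show 2 * i + 2 = ((2 * r : ℕ) : ℤ) by push_cast; omega,
      zpow_natCast]
    ring
  refine ⟨hfirst, fun α hα => ?_⟩
  rw [← hfirst]
  have : Fact p.Prime := ⟨hp⟩
  unfold wt
  congr 1
  refine Nat.card_congr (Equiv.subtypeEquivRight fun P => ?_)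
  simp only [vsub, Xor', Xor]
  by_cases h1 : IsHermPoint q P <;> by_cases h2 : P ≤ π <;> by_cases h3 : P ≤ polar q π <;>
    simp [h1, h2, h3, hα]

end HermCode
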